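/- (Asymptotic number of unbounded periodic bridges.) Suppose the walk is reduced (gcd of the elements of S equals 1) with fundamental period p := gcd{j + c : j ∈ S}. Then along lengths n = mp, the weighted number of bridges satisfies V_{mp} ∼ p · (1/τ)·√(P(τ)/P''(τ)) · P(τ)^{mp} / √(2π·mp) as m → ∞; that is, V_{mp} · τ · √(P''(τ)) · √(2π·mp) / (p · √(P(τ)) · P(τ)^{mp}) tends to 1 as m → ∞. -/

import Mathlib

open Filter

/-- The characteristic function `θ ↦ ∑ j ∈ S, a j * exp (i j θ)` of a step with weights `a`. -/
noncomputable def stepCharFun (S : Finset ℤ) (a : ℤ → ℝ) (θ : ℝ) : ℂ :=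
  ∑ j ∈ S, (a j : ℂ) * Complex.exp ((j : ℂ) * θ * Complex.I)

/-- The weighted number of closed walks of length `n`. -/
noncomputable def bridgeWeight (S : Finset ℤ) (a : ℤ → ℝ) (n : ℕ) : ℝ :=
  ∑ s ∈ (Fintype.piFinset fun _ : Fin n => S).filter (fun s => ∑ i, s i = 0), ∏ i, a (s i)

lemma continuous_stepCharFun (S : Finset ℤ) (a : ℤ → ℝ) : Continuous (stepCharFun S a) := by
  unfold stepCharFun
  fun_prop

lemma tendsto_natCast_mul_exp_sub_one_sub (x : ℝ) :
    Tendsto (fun n : ℕ => (n : ℂ) * (Complex.exp ((x / √(n : ℝ) : ℝ) * Complex.I) - 1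
      - (x / √(n : ℝ) : ℝ) * Complex.I)) atTop (nhds (-(x : ℂ) ^ 2 / 2)) := by
  have h0 : Tendsto (fun n : ℕ => √(n : ℝ)) atTop atTop :=
    Real.tendsto_sqrt_atTop.comp tendsto_natCast_atTop_atTop
  have h1 : Tendsto (fun n : ℕ => x / √(n : ℝ)) atTop (nhds 0) := h0.const_div_atTop x
  have h2 : Tendsto (fun n : ℕ => |x| ^ 3 / √(n : ℝ)) atTop (nhds 0) := h0.const_div_atTop _
  have h3 : ∀ᶠ n : ℕ in atTop, |x / √(n : ℝ)| < 1 := by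
    have := h1.abs
    rw [abs_zero] at this
    exact this.eventually_lt_const one_pos
  rw [tendsto_iff_norm_sub_tendsto_zero]
  refine squeeze_zero' (Eventually.of_forall fun _ => norm_nonneg _) ?_ h2
  filter_upwards [h3, eventually_gt_atTop 0] with n hn hpos
  have hs : 0 < √(n : ℝ) := Real.sqrt_pos.2 (by exact_mod_cast hpos)
  have hsq : √(n : ℝ) ^ 2 = n := Real.sq_sqrt (Nat.cast_nonneg n)
  set y : ℝ := x / √(n : ℝ) with hy
  have hxy : x = y * √(n : ℝ) := by rw [hy]; field_simp
  have hnorm : ‖(y : ℂ) * Complex.I‖ = |y| := by simp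
  have hb := Complex.exp_bound (x := (y : ℂ) * Complex.I) (by rw [hnorm]; exact hn.le)
    (n := 3) (by norm_num)
  rw [hnorm] at hb
  have hx2 : (x : ℂ) ^ 2 = n * (y : ℂ) ^ 2 := by
    have hsqc : ((√(n : ℝ) : ℝ) : ℂ) ^ 2 = n := by exact_mod_cast hsq
    rw [hxy, Complex.ofReal_mul, mul_pow, hsqc, mul_comm]
  have heq : (n : ℂ) * (Complex.exp (y * Complex.I) - 1 - y * Complex.I) - -(x : ℂ) ^ 2 / 2
      = n * (Complex.exp (y * Complex.I)
        - ∑ m ∈ Finset.range 3, (y * Complex.I) ^ m / m.factorial) := by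
    rw [hx2]
    simp [Finset.sum_range_succ, mul_pow, Nat.factorial]
    ring
  rw [heq, norm_mul, Complex.norm_natCast]
  calc (n : ℝ) * _ ≤ n * (|y| ^ 3 * (((3 : ℕ).succ : ℝ) * ((3 : ℕ).factorial * (3 : ℕ) : ℝ)⁻¹)) := by
        gcongr
    _ ≤ n * (|y| ^ 3 * 1) := by
        gcongr
        norm_num [Nat.factorial]
    _ = |x| ^ 3 / √(n : ℝ) := by
        rw [eq_div_iff hs.ne', hxy, abs_mul, abs_of_pos hs]
        linear_combination (-|y| ^ 3 * √(n : ℝ)) * hsq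

lemma tendsto_stepCharFun_pow (S : Finset ℤ) (a : ℤ → ℝ) (hsum : ∑ j ∈ S, a j = 1)
    (hmean : ∑ j ∈ S, a j * j = 0) (t : ℝ) :
    Tendsto (fun n : ℕ => stepCharFun S a (t / √(n : ℝ)) ^ n) atTop
      (nhds (Complex.exp (-((∑ j ∈ S, a j * (j : ℝ) ^ 2) / 2 * t ^ 2 : ℝ)))) := by
  have key : Tendsto (fun n : ℕ => (n : ℂ) * (stepCharFun S a (t / √(n : ℝ)) - 1)) atTop
      (nhds (-((∑ j ∈ S, a j * (j : ℝ) ^ 2) / 2 * t ^ 2 : ℝ))) := by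
    have h := tendsto_finsetSum S fun j _ =>
      (tendsto_natCast_mul_exp_sub_one_sub ((j : ℝ) * t)).const_mul (a j : ℂ)
    convert! h using 2 with n
    · have hs : (∑ j ∈ S, (a j : ℂ)) = 1 := by exact_mod_cast hsum
      have hm : (∑ j ∈ S, (a j : ℂ) * j) = 0 := by exact_mod_cast hmean
      have e : stepCharFun S a (t / √(n : ℝ)) - 1 = stepCharFun S a (t / √(n : ℝ))
          - ∑ j ∈ S, (a j : ℂ)
          - (∑ j ∈ S, (a j : ℂ) * j) * ((t / √(n : ℝ) : ℝ) * Complex.I) := by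
        rw [hs, hm]; ring
      rw [e, stepCharFun, Finset.sum_mul, ← Finset.sum_sub_distrib, ← Finset.sum_sub_distrib,
        Finset.mul_sum]
      refine Finset.sum_congr rfl fun j _ => ?_
      have : ((j : ℂ) * ((t / √(n : ℝ) : ℝ) : ℂ)) = (((j : ℝ) * t / √(n : ℝ) : ℝ) : ℂ) := by
        push_cast; ring
      rw [this, ← this]
      ring
    · push_cast
      rw [Finset.sum_div, Finset.sum_mul, ← Finset.sum_neg_distrib]
      refine Finset.sum_congr rfl fun j _ => ?_
      ring
  have := Complex.tendsto_one_add_pow_exp_of_tendsto key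
  simpa using this

lemma stepCharFun_pow_eq_sum (S : Finset ℤ) (a : ℤ → ℝ) (n : ℕ) (θ : ℝ) :
    stepCharFun S a θ ^ n = ∑ s ∈ Fintype.piFinset fun _ : Fin n => S,
      ((∏ i, a (s i) : ℝ) : ℂ) * Complex.exp (((∑ i, s i : ℤ) : ℂ) * Complex.I * θ) := by
  have h := Finset.prod_univ_sum (fun _ : Fin n => S)
    (fun _ (j : ℤ) => (a j : ℂ) * Complex.exp ((j : ℂ) * θ * Complex.I))
  rw [Finset.prod_const, Finset.card_univ, Fintype.card_fin] at h
  rw [stepCharFun, h]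
  refine Finset.sum_congr rfl fun s _ => ?_
  rw [Finset.prod_mul_distrib, ← Complex.exp_sum]
  push_cast
  congr 2
  rw [Finset.sum_mul, Finset.sum_mul]
  exact Finset.sum_congr rfl fun i _ => by ring

lemma integral_exp_int_mul (k : ℤ) :
    ∫ θ in (-Real.pi)..Real.pi, Complex.exp ((k : ℂ) * Complex.I * θ)
      = if k = 0 then (2 * Real.pi : ℂ) else 0 := by
  split_ifs with h
  · subst h
    simp
    ring
  · have hk : (k : ℂ) * Complex.I ≠ 0 := mul_ne_zero (by exact_mod_cast h) Complex.I_ne_zero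
    rw [integral_exp_mul_complex hk, div_eq_zero_iff, sub_eq_zero]
    left
    rw [Complex.exp_eq_exp_iff_exists_int]
    exact ⟨k, by push_cast; ring⟩

lemma integral_stepCharFun_pow (S : Finset ℤ) (a : ℤ → ℝ) (n : ℕ) :
    ∫ θ in (-Real.pi)..Real.pi, stepCharFun S a θ ^ n
      = 2 * Real.pi * (bridgeWeight S a n : ℂ) := by
  simp_rw [stepCharFun_pow_eq_sum]
  rw [intervalIntegral.integral_finsetSum
    fun s _ => Continuous.intervalIntegrable (by fun_prop) _ _]
  simp_rw [intervalIntegral.integral_const_mul, integral_exp_int_mul]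
  rw [bridgeWeight, Finset.sum_filter]
  push_cast
  rw [Finset.mul_sum]
  refine Finset.sum_congr rfl fun s _ => ?_
  split_ifs with h1
  · push_cast; ring
  · simp

lemma normSq_stepCharFun (S : Finset ℤ) (a : ℤ → ℝ) (θ : ℝ) :
    ‖stepCharFun S a θ‖ ^ 2
      = ∑ j ∈ S, ∑ k ∈ S, a j * a k * Real.cos (((j : ℝ) - k) * θ) := by
  have e : stepCharFun S a θ = ((∑ j ∈ S, a j * Real.cos (j * θ) : ℝ) : ℂ)
      + ((∑ j ∈ S, a j * Real.sin (j * θ) : ℝ) : ℂ) * Complex.I := by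
    rw [stepCharFun]
    push_cast
    rw [Finset.sum_mul, ← Finset.sum_add_distrib]
    refine Finset.sum_congr rfl fun j _ => ?_
    rw [Complex.exp_mul_I]
    ring
  rw [e, ← Complex.normSq_eq_norm_sq, Complex.normSq_add_mul_I, sq, sq, Finset.sum_mul_sum,
    Finset.sum_mul_sum, ← Finset.sum_add_distrib]
  refine Finset.sum_congr rfl fun j _ => ?_
  rw [← Finset.sum_add_distrib]
  refine Finset.sum_congr rfl fun k _ => ?_
  rw [sub_mul, Real.cos_sub]
  ring

lemma exists_norm_stepCharFun_le (S : Finset ℤ) (a : ℤ → ℝ) (ha : ∀ j ∈ S, 0 < a j)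
    (hsum : ∑ j ∈ S, a j = 1) (hS : ∃ j ∈ S, ∃ k ∈ S, j ≠ k) {r : ℝ} (hr : 0 < r)
    (hsin : ∀ θ ∈ Set.Icc (-r) r, θ ≠ 0 →
      ∃ j ∈ S, ∃ k ∈ S, Real.sin (((j : ℝ) - k) * θ / 2) ≠ 0) :
    ∃ κ > 0, ∀ θ ∈ Set.Icc (-r) r, ‖stepCharFun S a θ‖ ≤ Real.exp (-κ * θ ^ 2) := by
  set H : ℝ → ℝ := fun θ => ∑ j ∈ S, ∑ k ∈ S,
    a j * a k * (((j : ℝ) - k) ^ 2 / 2 * Real.sinc (((j : ℝ) - k) * θ / 2) ^ 2) with hH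
  have hHcont : Continuous H := by
    have := Real.continuous_sinc
    fun_prop
  have hterm : ∀ θ : ℝ, ∀ j ∈ S, ∀ k ∈ S,
      0 ≤ a j * a k * (((j : ℝ) - k) ^ 2 / 2 * Real.sinc (((j : ℝ) - k) * θ / 2) ^ 2) :=
    fun θ j hj k hk => mul_nonneg (mul_nonneg (ha j hj).le (ha k hk).le) (by positivity)
  have hHpos : ∀ θ ∈ Set.Icc (-r) r, 0 < H θ := by
    intro θ hθ
    obtain ⟨j, hj, k, hk, hjk, hs⟩ : ∃ j ∈ S, ∃ k ∈ S, ((j : ℝ) - k) ≠ 0 ∧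
        Real.sinc (((j : ℝ) - k) * θ / 2) ≠ 0 := by
      rcases eq_or_ne θ 0 with rfl | h0
      · obtain ⟨j, hj, k, hk, hjk⟩ := hS
        exact ⟨j, hj, k, hk, sub_ne_zero.2 (by exact_mod_cast hjk), by simp⟩
      · obtain ⟨j, hj, k, hk, hs⟩ := hsin θ hθ h0
        have hjk : ((j : ℝ) - k) ≠ 0 := by
          intro h
          simp [h] at hs
        refine ⟨j, hj, k, hk, hjk, ?_⟩
        have h1 : ((j : ℝ) - k) * θ / 2 ≠ 0 := by positivity
        rw [Real.sinc_of_ne_zero h1]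
        exact div_ne_zero hs h1
    refine Finset.sum_pos' (fun j hj => Finset.sum_nonneg (hterm θ j hj)) ⟨j, hj, ?_⟩
    refine Finset.sum_pos' (hterm θ j hj) ⟨k, hk, ?_⟩
    have := ha j hj
    have := ha k hk
    positivity
  have hHeq : ∀ θ, ‖stepCharFun S a θ‖ ^ 2 = 1 - θ ^ 2 * H θ := by
    intro θ
    have h1 : (1 : ℝ) = ∑ j ∈ S, ∑ k ∈ S, a j * a k := by
      rw [← Finset.sum_mul_sum, hsum, one_mul]
    rw [normSq_stepCharFun, h1, hH]
    simp only
    rw [Finset.mul_sum, ← Finset.sum_sub_distrib]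
    refine Finset.sum_congr rfl fun j _ => ?_
    rw [Finset.mul_sum, ← Finset.sum_sub_distrib]
    refine Finset.sum_congr rfl fun k _ => ?_
    set y : ℝ := ((j : ℝ) - k) * θ / 2 with hy
    have hsy : Real.sin y = y * Real.sinc y := by
      rcases eq_or_ne y 0 with h | h
      · simp [h]
      · rw [Real.sinc_of_ne_zero h]; field_simp
    have hc : Real.cos (((j : ℝ) - k) * θ) = 1 - 2 * (y * Real.sinc y) ^ 2 := by
      rw [← hsy, show ((j : ℝ) - k) * θ = 2 * y by rw [hy]; ring, Real.cos_two_mul,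
        Real.cos_sq']
      ring
    rw [hc, mul_pow, hy]
    ring
  obtain ⟨θ₀, hθ₀, hmin⟩ := isCompact_Icc.exists_isMinOn
    (Set.nonempty_Icc.2 (by linarith : -r ≤ r)) hHcont.continuousOn
  refine ⟨H θ₀ / 2, half_pos (hHpos _ hθ₀), fun θ hθ => ?_⟩
  refine (sq_le_sq₀ (norm_nonneg _) (Real.exp_pos _).le).1 ?_
  rw [hHeq, ← Real.exp_nat_mul]
  have h1 : H θ₀ ≤ H θ := hmin hθ
  have h2 := Real.add_one_le_exp (((2 : ℕ) : ℝ) * (-(H θ₀ / 2) * θ ^ 2))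
  push_cast at h2 ⊢
  nlinarith [mul_le_mul_of_nonneg_left h1 (sq_nonneg θ)]

lemma tendsto_sqrt_mul_integral_stepCharFun_pow (S : Finset ℤ) (a : ℤ → ℝ)
    (hsum : ∑ j ∈ S, a j = 1) (hmean : ∑ j ∈ S, a j * j = 0) {r κ : ℝ} (hr : 0 < r)
    (hκ : 0 < κ)
    (hbound : ∀ θ ∈ Set.Icc (-r) r, ‖stepCharFun S a θ‖ ≤ Real.exp (-κ * θ ^ 2)) :
    Tendsto (fun n : ℕ => (√(n : ℝ) : ℂ) * ∫ θ in (-r)..r, stepCharFun S a θ ^ n) atTop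
      (nhds (√(Real.pi / ((∑ j ∈ S, a j * (j : ℝ) ^ 2) / 2)) : ℝ)) := by
  have hlim : Tendsto (fun n : ℕ => ∫ t : ℝ, (Set.Ioc (-r * √(n : ℝ)) (r * √(n : ℝ))).indicator
      (fun t => stepCharFun S a (t / √(n : ℝ)) ^ n) t) atTop
      (nhds (∫ t : ℝ, Complex.exp (-((∑ j ∈ S, a j * (j : ℝ) ^ 2) / 2 * t ^ 2 : ℝ)))) := by
    refine MeasureTheory.tendsto_integral_filter_of_dominated_convergence
      (fun t => Real.exp (-κ * t ^ 2)) ?_ ?_ (integrable_exp_neg_mul_sq hκ) ?_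
    · refine Eventually.of_forall fun n => ?_
      refine (Continuous.aestronglyMeasurable ?_).indicator measurableSet_Ioc
      exact ((continuous_stepCharFun S a).comp (continuous_id.div_const _)).pow n
    · filter_upwards [eventually_gt_atTop 0] with n hn
      refine Eventually.of_forall fun t => ?_
      have hs : 0 < √(n : ℝ) := Real.sqrt_pos.2 (by exact_mod_cast hn)
      have hsq : √(n : ℝ) ^ 2 = n := Real.sq_sqrt (Nat.cast_nonneg n)
      by_cases ht : t ∈ Set.Ioc (-r * √(n : ℝ)) (r * √(n : ℝ))
      · rw [Set.indicator_of_mem ht, norm_pow]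
        have h1 := hbound (t / √(n : ℝ))
          ⟨by rw [le_div_iff₀ hs]; exact ht.1.le, by rw [div_le_iff₀ hs]; exact ht.2⟩
        calc _ ≤ Real.exp (-κ * (t / √(n : ℝ)) ^ 2) ^ n := by gcongr
          _ = Real.exp (-κ * t ^ 2) := by
            rw [← Real.exp_nat_mul, div_pow, hsq]
            congr 1
            field_simp
      · rw [Set.indicator_of_notMem ht, norm_zero]
        exact (Real.exp_pos _).le
    · refine Eventually.of_forall fun t => ?_
      refine (tendsto_stepCharFun_pow S a hsum hmean t).congr' ?_
      have h0 : Tendsto (fun n : ℕ => r * √(n : ℝ)) atTop atTop :=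
        (Real.tendsto_sqrt_atTop.comp tendsto_natCast_atTop_atTop).const_mul_atTop hr
      filter_upwards [h0.eventually_gt_atTop |t|] with n hn
      rw [Set.indicator_of_mem]
      rw [abs_lt] at hn
      exact ⟨by linarith [hn.1], hn.2.le⟩
  have hgauss : ∫ t : ℝ, Complex.exp (-((∑ j ∈ S, a j * (j : ℝ) ^ 2) / 2 * t ^ 2 : ℝ))
      = ((√(Real.pi / ((∑ j ∈ S, a j * (j : ℝ) ^ 2) / 2)) : ℝ) : ℂ) := by
    rw [← integral_gaussian, ← integral_complex_ofReal]
    congr 1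
    ext t
    push_cast
    congr 1
    ring
  rw [hgauss] at hlim
  refine hlim.congr' ?_
  filter_upwards [eventually_gt_atTop 0] with n hn
  have hs : 0 < √(n : ℝ) := Real.sqrt_pos.2 (by exact_mod_cast hn)
  rw [MeasureTheory.integral_indicator measurableSet_Ioc,
    ← intervalIntegral.integral_of_le (by nlinarith),
    intervalIntegral.integral_comp_div (fun θ => stepCharFun S a θ ^ n) hs.ne',
    mul_div_cancel_right₀ _ hs.ne', mul_div_cancel_right₀ _ hs.ne', Complex.real_smul]

lemma stepCharFun_pow_periodic (S : Finset ℤ) (a : ℤ → ℝ) (c : ℤ) {q : ℕ} (hq : 0 < q)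
    (hdvd : ∀ j ∈ S, (q : ℤ) ∣ j + c) (m : ℕ) :
    Function.Periodic (fun θ => stepCharFun S a θ ^ (m * q)) (2 * Real.pi / q) := by
  intro θ
  have hq' : (q : ℂ) ≠ 0 := by exact_mod_cast hq.ne'
  have h1 : stepCharFun S a (θ + 2 * Real.pi / q)
      = Complex.exp (-(c : ℂ) * (2 * Real.pi / q) * Complex.I) * stepCharFun S a θ := by
    rw [stepCharFun, stepCharFun, Finset.mul_sum]
    refine Finset.sum_congr rfl fun j hj => ?_
    obtain ⟨l, hl⟩ := hdvd j hj
    rw [mul_left_comm, ← Complex.exp_add]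
    congr 1
    rw [Complex.exp_eq_exp_iff_exists_int]
    refine ⟨l, ?_⟩
    have hj' : (j : ℂ) = q * l - c := by
      rw [eq_sub_iff_add_eq]
      exact_mod_cast hl
    rw [hj']
    push_cast
    field_simp
    ring
  have h2 : Complex.exp (-(c : ℂ) * (2 * Real.pi / q) * Complex.I) ^ (m * q) = 1 := by
    rw [← Complex.exp_nat_mul, Complex.exp_eq_one_iff]
    refine ⟨-c * m, ?_⟩
    push_cast
    field_simp
  simp only
  rw [h1, mul_pow, h2, one_mul]

lemma integral_stepCharFun_pow_mul (S : Finset ℤ) (a : ℤ → ℝ) (c : ℤ) {q : ℕ} (hq : 0 < q)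
    (hdvd : ∀ j ∈ S, (q : ℤ) ∣ j + c) (m : ℕ) :
    ∫ θ in (-Real.pi)..Real.pi, stepCharFun S a θ ^ (m * q)
      = q * ∫ θ in (-(Real.pi / q))..(Real.pi / q), stepCharFun S a θ ^ (m * q) := by
  have hq' : (q : ℝ) ≠ 0 := by exact_mod_cast hq.ne'
  have hper := stepCharFun_pow_periodic S a c hq hdvd m
  have h1 := hper.intervalIntegral_add_zsmul_eq (q : ℤ) (-Real.pi)
    fun _ _ => ((continuous_stepCharFun S a).pow _).intervalIntegrable _ _
  have h2 := hper.intervalIntegral_add_eq (-Real.pi) (-(Real.pi / q))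
  have e1 : -Real.pi + (q : ℤ) • (2 * Real.pi / q) = Real.pi := by
    simp only [natCast_zsmul, nsmul_eq_mul]
    field_simp
    ring
  have e2 : -(Real.pi / q) + 2 * Real.pi / q = Real.pi / q := by ring
  rw [e1, h2, e2] at h1
  rw [h1]
  simp

lemma exists_sin_ne_zero (S : Finset ℤ) (c : ℤ) (hcS : -c ∈ S) {q : ℕ} (hq : 0 < q)
    (hgcd : (q : ℤ) = S.gcd (fun j => j + c)) {θ : ℝ}
    (hθ : θ ∈ Set.Icc (-(Real.pi / q)) (Real.pi / q)) (h0 : θ ≠ 0) :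
    ∃ j ∈ S, ∃ k ∈ S, Real.sin (((j : ℝ) - k) * θ / 2) ≠ 0 := by
  by_contra! h
  have hq' : (0 : ℝ) < q := by exact_mod_cast hq
  let H : AddSubgroup ℤ :=
    (AddSubgroup.zmultiples (2 * Real.pi)).comap (zmultiplesHom ℝ θ)
  have hmem : ∀ k : ℤ, k ∈ H ↔ ∃ l : ℤ, (l : ℝ) * (2 * Real.pi) = k * θ := by
    intro k
    simp [H, AddSubgroup.mem_zmultiples_iff]
  have hqH : (q : ℤ) ∈ H := by
    obtain ⟨b, hb⟩ := Int.subgroup_cyclic H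
    have hdvd : b ∣ S.gcd (fun j => j + c) := by
      refine Finset.dvd_gcd fun j hj => ?_
      have hjH : j + c ∈ H := by
        rw [hmem]
        obtain ⟨l, hl⟩ := Real.sin_eq_zero_iff.1 (h j hj (-c) hcS)
        refine ⟨l, ?_⟩
        push_cast at hl ⊢
        linarith
      rw [hb, AddSubgroup.mem_closure_singleton] at hjH
      obtain ⟨l, hl⟩ := hjH
      exact ⟨l, by rw [← hl, smul_eq_mul, mul_comm]⟩
    rw [← hgcd] at hdvd
    obtain ⟨l, hl⟩ := hdvd
    rw [hb, AddSubgroup.mem_closure_singleton]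
    exact ⟨l, by rw [hl, smul_eq_mul, mul_comm]⟩
  obtain ⟨l, hl⟩ := (hmem _).1 hqH
  push_cast at hl
  have hpi := Real.pi_pos
  have hle : |(q : ℝ) * θ| ≤ Real.pi := by
    rw [abs_mul, abs_of_pos hq', ← le_div_iff₀' hq']
    exact abs_le.2 hθ
  rw [← hl, abs_mul, abs_of_pos (by positivity : 0 < 2 * Real.pi)] at hle
  have hl1 : |(l : ℝ)| < 1 := by
    by_contra! h1
    nlinarith
  have hl0 : l = 0 := Int.abs_lt_one_iff.1 (by exact_mod_cast hl1)
  rw [hl0, Int.cast_zero, zero_mul] at hl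
  exact (mul_ne_zero hq'.ne' h0) hl.symm

/-- Local limit theorem at the origin for a centred lattice walk with period `q`. -/
theorem tendsto_sqrt_mul_bridgeWeight (S : Finset ℤ) (a : ℤ → ℝ) (ha : ∀ j ∈ S, 0 < a j)
    (hsum : ∑ j ∈ S, a j = 1) (hmean : ∑ j ∈ S, a j * j = 0) (c : ℤ) (hcS : -c ∈ S)
    (hS : ∃ j ∈ S, ∃ k ∈ S, j ≠ k) {q : ℕ} (hq : 0 < q)
    (hgcd : (q : ℤ) = S.gcd (fun j => j + c)) :
    Tendsto (fun m : ℕ => √((m * q : ℕ) : ℝ) * bridgeWeight S a (m * q)) atTop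
      (nhds (q / (2 * Real.pi) * √(Real.pi / ((∑ j ∈ S, a j * (j : ℝ) ^ 2) / 2)))) := by
  have hq' : (0 : ℝ) < q := by exact_mod_cast hq
  have hr : 0 < Real.pi / q := div_pos Real.pi_pos hq'
  obtain ⟨κ, hκ, hbound⟩ := exists_norm_stepCharFun_le S a ha hsum hS hr
    fun θ hθ h0 => exists_sin_ne_zero S c hcS hq hgcd hθ h0
  have hmq : Tendsto (fun m : ℕ => m * q) atTop atTop := tendsto_id.atTop_mul_const' hq
  have h := ((tendsto_sqrt_mul_integral_stepCharFun_pow S a hsum hmean hr hκ hbound).comp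
    hmq).const_mul ((q / (2 * Real.pi) : ℝ) : ℂ)
  rw [← Complex.ofReal_mul] at h
  refine tendsto_ofReal_iff.1 (h.congr fun m => ?_)
  have hdvd : ∀ j ∈ S, (q : ℤ) ∣ j + c := fun j hj => hgcd ▸ Finset.gcd_dvd hj
  have e := integral_stepCharFun_pow S a (m * q)
  rw [integral_stepCharFun_pow_mul S a c hq hdvd m] at e
  have hpi : (Real.pi : ℂ) ≠ 0 := by exact_mod_cast Real.pi_ne_zero
  have e2 : (bridgeWeight S a (m * q) : ℂ) = q / (2 * Real.pi)
      * ∫ θ in (-(Real.pi / q))..(Real.pi / q), stepCharFun S a θ ^ (m * q) := by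
    rw [div_mul_eq_mul_div, e]
    field_simp
  simp only [Function.comp_apply]
  push_cast
  rw [e2]
  ring

lemma prod_zpow_eq_zpow_sum {ι : Type*} {τ : ℝ} (hτ : τ ≠ 0) (t : Finset ι) (f : ι → ℤ) :
    ∏ i ∈ t, τ ^ f i = τ ^ ∑ i ∈ t, f i := by
  induction t using Finset.cons_induction with
  | empty => simp
  | cons i t hi ih => rw [Finset.prod_cons, Finset.sum_cons, zpow_add₀ hτ, ih]

lemma bridgeWeight_tilt (S : Finset ℤ) (p : ℤ → ℝ) {τ : ℝ} (hτ : τ ≠ 0) (N : ℝ) (n : ℕ) :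
    bridgeWeight S (fun j => p j * τ ^ j / N) n = bridgeWeight S p n / N ^ n := by
  rw [bridgeWeight, bridgeWeight, Finset.sum_div]
  refine Finset.sum_congr rfl fun s hs => ?_
  have h0 : ∏ i, τ ^ s i = 1 := by
    rw [← zpow_zero τ, ← (Finset.mem_filter.1 hs).2]
    exact prod_zpow_eq_zpow_sum hτ _ _
  rw [Finset.prod_div_distrib, Finset.prod_mul_distrib, h0, mul_one, Finset.prod_const,
    Finset.card_univ, Fintype.card_fin]

lemma hasDerivAt_sum_zpow (S : Finset ℤ) (p : ℤ → ℝ) {u : ℝ} (hu : u ≠ 0) :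
    HasDerivAt (fun u : ℝ => ∑ j ∈ S, p j * u ^ j) (∑ j ∈ S, p j * j * u ^ (j - 1)) u := by
  refine HasDerivAt.fun_sum fun j _ => ?_
  simpa [mul_assoc] using (hasDerivAt_zpow j u (Or.inl hu)).const_mul (p j)

lemma sq_mul_deriv_deriv_sum_zpow (S : Finset ℤ) (p : ℤ → ℝ) {u : ℝ} (hu : u ≠ 0) :
    u ^ 2 * deriv (deriv fun u : ℝ => ∑ j ∈ S, p j * u ^ j) u
      = ∑ j ∈ S, p j * u ^ j * (j : ℝ) ^ 2 - ∑ j ∈ S, p j * u ^ j * j := by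
  have h1 : deriv (fun u : ℝ => ∑ j ∈ S, p j * u ^ j)
      =ᶠ[nhds u] fun u => ∑ j ∈ S, p j * j * u ^ (j - 1) := by
    filter_upwards [isOpen_ne.mem_nhds hu] with v hv
    exact (hasDerivAt_sum_zpow S p hv).deriv
  have h2 : HasDerivAt (fun u : ℝ => ∑ j ∈ S, p j * j * u ^ (j - 1))
      (∑ j ∈ S, p j * j * ((j - 1 : ℤ) * u ^ (j - 1 - 1))) u :=
    HasDerivAt.fun_sum fun j _ => (hasDerivAt_zpow (j - 1) u (Or.inl hu)).const_mul _
  rw [h1.deriv_eq, h2.deriv, Finset.mul_sum, ← Finset.sum_sub_distrib]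
  refine Finset.sum_congr rfl fun j _ => ?_
  rw [zpow_sub_one₀ hu, zpow_sub_one₀ hu]
  push_cast
  field_simp

/-- Asymptotic number of unbounded periodic bridges along lengths `n = mp`:
`V_{mp} ∼ p · (1/τ)·√(P(τ)/P''(τ)) · P(τ)^{mp} / √(2π·mp)`, stated as the quotient
`V_{mp} · τ · √(P''(τ)) · √(2π·mp) / (p · √(P(τ)) · P(τ)^{mp}) → 1`. -/
theorem stmt16
    (S : Finset ℤ) (hne : S.Nonempty)
    (hmin : S.min' hne < 0) (hmax : 0 < S.max' hne)
    (p : ℤ → ℝ) (hp : ∀ j ∈ S, 0 < p j)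
    (c : ℤ) (hc : c = -S.min' hne)
    (hred : S.gcd id = 1)
    (q : ℕ) (hq : (q : ℤ) = S.gcd (fun j => j + c))
    (P : ℝ → ℝ) (hP : ∀ u : ℝ, P u = ∑ j ∈ S, p j * u ^ j)
    (τ : ℝ) (hτ : 0 < τ) (hτ' : deriv P τ = 0)
    (V : ℕ → ℝ)
    (hV : ∀ n : ℕ, V n = ∑ s ∈ (Fintype.piFinset fun _ : Fin n => S).filter
        (fun s => ∑ i, s i = 0), ∏ i, p (s i)) :
    Tendsto (fun m : ℕ =>
        V (m * q) * τ * Real.sqrt (deriv (deriv P) τ) *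
            Real.sqrt (2 * Real.pi * ((m * q : ℕ) : ℝ)) /
          ((q : ℝ) * Real.sqrt (P τ) * P τ ^ (m * q))) atTop (nhds 1) := by
  have hminS := S.min'_mem hne
  have hmaxS := S.max'_mem hne
  have hcS : -c ∈ S := by rw [hc, neg_neg]; exact hminS
  have hS : ∃ j ∈ S, ∃ k ∈ S, j ≠ k := ⟨_, hminS, _, hmaxS, (hmin.trans hmax).ne⟩
  have hq0 : 0 < q := by
    rw [Nat.pos_iff_ne_zero]
    rintro rfl
    have := Finset.gcd_eq_zero_iff.1 hq.symm _ hmaxS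
    omega
  obtain rfl : P = fun u => ∑ j ∈ S, p j * u ^ j := funext hP
  obtain rfl : V = bridgeWeight S p := funext hV
  have hPpos : 0 < ∑ j ∈ S, p j * τ ^ j :=
    Finset.sum_pos (fun j hj => mul_pos (hp j hj) (zpow_pos hτ j)) hne
  have hmean : ∑ j ∈ S, p j * τ ^ j * j = 0 := by
    rw [(hasDerivAt_sum_zpow S p hτ.ne').deriv] at hτ'
    calc ∑ j ∈ S, p j * τ ^ j * j = τ * ∑ j ∈ S, p j * j * τ ^ (j - 1) := by
          rw [Finset.mul_sum]
          refine Finset.sum_congr rfl fun j _ => ?_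
          rw [zpow_sub_one₀ hτ.ne']
          field_simp
      _ = 0 := by rw [hτ', mul_zero]
  have hvar := sq_mul_deriv_deriv_sum_zpow S p hτ.ne'
  rw [hmean, sub_zero] at hvar
  set D := deriv (deriv fun u : ℝ => ∑ j ∈ S, p j * u ^ j) τ
  have hDpos : 0 < D := by
    have : 0 < τ ^ 2 * D := by
      rw [hvar]
      refine Finset.sum_pos' (fun j hj => ?_) ⟨_, hmaxS, ?_⟩
      · exact mul_nonneg (mul_pos (hp j hj) (zpow_pos hτ j)).le (sq_nonneg _)
      · have := hp _ hmaxS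
        have : (0 : ℝ) < (S.max' hne : ℝ) := by exact_mod_cast hmax
        positivity
    exact pos_of_mul_pos_right this (sq_nonneg _)
  simp only
  set N := ∑ j ∈ S, p j * τ ^ j with hN
  have h := tendsto_sqrt_mul_bridgeWeight S (fun j => p j * τ ^ j / N)
    (fun j hj => div_pos (mul_pos (hp j hj) (zpow_pos hτ j)) hPpos)
    (by rw [← Finset.sum_div, ← hN, div_self hPpos.ne'])
    (by simp_rw [div_mul_eq_mul_div]; rw [← Finset.sum_div, hmean, zero_div])
    c hcS hS hq0 hq
  have hvar' : ∑ j ∈ S, p j * τ ^ j / N * (j : ℝ) ^ 2 = τ ^ 2 * D / N := by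
    simp_rw [div_mul_eq_mul_div]
    rw [← Finset.sum_div, hvar]
  rw [hvar'] at h
  have hq' : (0 : ℝ) < q := by exact_mod_cast hq0
  have h2 := h.const_mul (τ * √D * √(2 * Real.pi) / (q * √N))
  have hlim : τ * √D * √(2 * Real.pi) / (q * √N)
      * (q / (2 * Real.pi) * √(Real.pi / (τ ^ 2 * D / N / 2))) = 1 := by
    have e : Real.pi / (τ ^ 2 * D / N / 2) = 2 * Real.pi * N / (τ ^ 2 * D) := by
      field_simp
    have hD := Real.sqrt_pos.2 hDpos
    have hNs := Real.sqrt_pos.2 hPpos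
    rw [e, Real.sqrt_div (by positivity), Real.sqrt_mul (by positivity) N,
      Real.sqrt_mul (by positivity) D, Real.sqrt_sq hτ.le]
    have h2pi : √(2 * Real.pi) ^ 2 = 2 * Real.pi := Real.sq_sqrt (by positivity)
    have hpi := Real.pi_pos
    field_simp
    linarith
  rw [hlim] at h2
  refine h2.congr fun m => ?_
  rw [bridgeWeight_tilt S p hτ.ne', Real.sqrt_mul (by positivity : 0 ≤ 2 * Real.pi)]
  ring
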